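/- arXiv:1911.12940 — 3 statements merged into one kernel-verified Lean document; each statement's English description precedes it below -/
import Mathlib

section
/- A regular T2 space X is a Nagata space if and only if ℱ(X), the space of nonempty finite subsets of X with the Vietoris topology, is a Nagata space. -/
open TopologicalSpace Set

/-- The hyperspace `𝒦(X)` of nonempty compact subsets of `X`. -/
structure VHyper (X : Type*) [TopologicalSpace X] where
  carrier : Set X
  isCompact' : IsCompact carrier
  nonempty' : carrier.Nonempty

namespace VHyper

variable {X : Type*} [TopologicalSpace X]

/-- The basic Vietoris set `⟨P₁, …, P_r⟩` determined by a finite family of subsets of `X`: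
all nonempty compact sets contained in the union and meeting every member. -/
def vbox (Ps : Finset (Set X)) : Set (VHyper X) :=
  {A : VHyper X | A.carrier ⊆ ⋃₀ (Ps : Set (Set X)) ∧ ∀ P ∈ Ps, (A.carrier ∩ P).Nonempty}

/-- The Vietoris topology on `𝒦(X)`, generated by the sets `⟨U₁, …, U_k⟩`
with all `U_i` open. -/
instance : TopologicalSpace (VHyper X) :=
  TopologicalSpace.generateFrom
    {S : Set (VHyper X) | ∃ Ps : Finset (Set X), (∀ U ∈ Ps, IsOpen U) ∧ S = vbox Ps}

end VHyper

/-- `ℱ(X)`: the subspace of `𝒦(X)` consisting of the nonempty finite subsets of `X`. -/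
def VFin (X : Type*) [TopologicalSpace X] := {A : VHyper X // A.carrier.Finite}

instance (X : Type*) [TopologicalSpace X] : TopologicalSpace (VFin X) :=
  inferInstanceAs (TopologicalSpace {A : VHyper X // A.carrier.Finite})

/-- `ℱ₂(X)`: the subspace of `𝒦(X)` consisting of the nonempty subsets of `X` of
cardinality at most 2. -/
def VFin2 (X : Type*) [TopologicalSpace X] := {A : VHyper X // A.carrier.encard ≤ 2}

instance (X : Type*) [TopologicalSpace X] : TopologicalSpace (VFin2 X) :=
  inferInstanceAs (TopologicalSpace {A : VHyper X // A.carrier.encard ≤ 2})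

/-- The family `ℬ = {⟨P₁,…,P_r⟩ : P₁,…,P_r ∈ Pfam, r ∈ ℕ}` of basic Vietoris sets built from
members of `Pfam`. -/
def boxFamily {X : Type*} [TopologicalSpace X] (Pfam : Set (Set X)) : Set (Set (VHyper X)) :=
  {B | ∃ Ps : Finset (Set X), Ps.Nonempty ∧ ↑Ps ⊆ Pfam ∧ B = VHyper.vbox Ps}

section Defs

variable {Y : Type*} [TopologicalSpace Y]

/-- `Pfam` is a k-network: for every compact `C` and open `U ⊇ C` there is a finite
subfamily `Qfam ⊆ Pfam` with `C ⊆ ⋃Qfam ⊆ U`. -/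
def IsKNetwork (Pfam : Set (Set Y)) : Prop :=
  ∀ C : Set Y, IsCompact C → ∀ U : Set Y, IsOpen U → C ⊆ U →
    ∃ Qfam : Set (Set Y), Qfam ⊆ Pfam ∧ Qfam.Finite ∧ C ⊆ ⋃₀ Qfam ∧ ⋃₀ Qfam ⊆ U

/-- Every point lies in at most countably many members of `Pfam`. -/
def PointCountableFam (Pfam : Set (Set Y)) : Prop :=
  ∀ y : Y, {P ∈ Pfam | y ∈ P}.Countable

/-- Every compact set meets at most countably many members of `Pfam`. -/
def CompactCountableFam (Pfam : Set (Set Y)) : Prop :=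
  ∀ C : Set Y, IsCompact C → {P ∈ Pfam | (C ∩ P).Nonempty}.Countable

/-- Every point has a neighborhood meeting at most countably many members of `Pfam`. -/
def LocallyCountableFam (Pfam : Set (Set Y)) : Prop :=
  ∀ y : Y, ∃ O ∈ nhds y, {P ∈ Pfam | (O ∩ P).Nonempty}.Countable

/-- Every point has a neighborhood meeting only finitely many members of `Pfam`. -/
def LocallyFiniteFam (Pfam : Set (Set Y)) : Prop :=
  ∀ y : Y, ∃ O ∈ nhds y, {P ∈ Pfam | (O ∩ P).Nonempty}.Finite

/-- Every compact set meets only finitely many members of `Pfam`. -/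
def CompactFiniteFam (Pfam : Set (Set Y)) : Prop :=
  ∀ C : Set Y, IsCompact C → {P ∈ Pfam | (C ∩ P).Nonempty}.Finite

/-- `Pfam` is a base for the topology: all members are open, and every open set is a union of
members around each of its points. -/
def IsBaseFam (Pfam : Set (Set Y)) : Prop :=
  (∀ P ∈ Pfam, IsOpen P) ∧ ∀ U : Set Y, IsOpen U → ∀ y ∈ U, ∃ P ∈ Pfam, y ∈ P ∧ P ⊆ U

/-- `Pfam` is hereditarily closure-preserving: whenever `S P ⊆ P` is chosen for each `P ∈ Pfam`,
the resulting family is closure-preserving. -/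
def IsHCP (Pfam : Set (Set Y)) : Prop :=
  ∀ S : Set Y → Set Y, (∀ P ∈ Pfam, S P ⊆ P) →
    ∀ Qfam ⊆ Pfam, closure (⋃ P ∈ Qfam, S P) = ⋃ P ∈ Qfam, closure (S P)

/-- `Pfam = ⋃_{y} Pfam y` is a weak base: each `Pfam y` consists of sets containing `y`, is directed
downward, every open neighborhood of `y` contains a member of `Pfam y`, and a set `G` is open
whenever each of its points has a member of its family inside `G`. -/
def IsWeakBase (Pfam : Y → Set (Set Y)) : Prop :=
  (∀ y, ∀ P ∈ Pfam y, y ∈ P) ∧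
  (∀ y, ∀ U ∈ Pfam y, ∀ V ∈ Pfam y, ∃ W ∈ Pfam y, W ⊆ U ∩ V) ∧
  (∀ y, ∀ U : Set Y, IsOpen U → y ∈ U → ∃ P ∈ Pfam y, P ⊆ U) ∧
  (∀ G : Set Y, (∀ y ∈ G, ∃ P ∈ Pfam y, P ⊆ G) → IsOpen G)

end Defs

/-- An ℵ-space: a space with a σ-locally finite k-network. -/
def IsAlephSpace (Y : Type*) [TopologicalSpace Y] : Prop :=
  ∃ Pfam : ℕ → Set (Set Y), (∀ n, LocallyFiniteFam (Pfam n)) ∧ IsKNetwork (⋃ n, Pfam n)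

/-- A space with a σ-hereditarily closure-preserving k-network. -/
def HasSigmaHCPKNetwork (Y : Type*) [TopologicalSpace Y] : Prop :=
  ∃ Pfam : ℕ → Set (Set Y), (∀ n, IsHCP (Pfam n)) ∧ IsKNetwork (⋃ n, Pfam n)

/-- k*-metrizable: a space with a σ-compact-finite k-network. -/
def KStarMetrizable (Y : Type*) [TopologicalSpace Y] : Prop :=
  ∃ Pfam : ℕ → Set (Set Y), (∀ n, CompactFiniteFam (Pfam n)) ∧ IsKNetwork (⋃ n, Pfam n)

/-- A Nagata space: for every point there are open neighborhood sequences `U n y`, `V n y`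
such that `{U n y}` is a decreasing local base at `y` and `z ∉ U n y` implies
`V n y ∩ V n z = ∅`. -/
def IsNagataSpace (Y : Type*) [TopologicalSpace Y] : Prop :=
  ∃ U V : ℕ → Y → Set Y,
    (∀ n y, IsOpen (U n y)) ∧ (∀ n y, y ∈ U n y) ∧
    (∀ n y, IsOpen (V n y)) ∧ (∀ n y, y ∈ V n y) ∧
    (∀ n y, U (n + 1) y ⊆ U n y) ∧
    (∀ y, ∀ W : Set Y, IsOpen W → y ∈ W → ∃ n, U n y ⊆ W) ∧
    (∀ n y z, z ∉ U n y → V n y ∩ V n z = ∅)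

def gbox {X : Type*} [TopologicalSpace X] (G : X → Set X) (A : Set X) : Set (VHyper X) :=
  {B | (∀ b ∈ B.carrier, ∃ a ∈ A, b ∈ G a) ∧ ∀ a ∈ A, ∃ b ∈ B.carrier, b ∈ G a}

theorem gbox_open {X : Type*} [TopologicalSpace X] (G : X → Set X) (A : Set X)
    (hA : A.Finite) (hG : ∀ a, IsOpen (G a)) : IsOpen (gbox G A) := by
  classical
  apply TopologicalSpace.isOpen_generateFrom_of_mem
  refine ⟨hA.toFinset.image G, ?_, ?_⟩
  · intro U hU
    simp only [Finset.mem_image] at hU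
    obtain ⟨a, _, rfl⟩ := hU
    exact hG a
  · ext B
    simp [gbox, VHyper.vbox, Set.subset_def, Set.Nonempty]

theorem gbox_base {X : Type*} [TopologicalSpace X] (U : ℕ → X → Set X)
    (hanti : ∀ y, Antitone (fun n => U n y))
    (hbase : ∀ y, ∀ W : Set X, IsOpen W → y ∈ W → ∃ n, U n y ⊆ W)
    (S : Set (VHyper X)) (hS : IsOpen S) (A : VHyper X) (hA : A.carrier.Finite) (hAS : A ∈ S) :
    ∃ n, ∀ m ≥ n, gbox (U m) A.carrier ⊆ S := by
  induction hS with
  | basic s hs =>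
    obtain ⟨Ps, hPs, rfl⟩ := hs
    have h1 : ∀ a : X, ∃ n, ∀ P ∈ Ps, a ∈ P → U n a ⊆ P := by
      intro a
      have ho : IsOpen (⋂ P ∈ {P | P ∈ Ps ∧ a ∈ P}, P) := by
        apply Set.Finite.isOpen_biInter (Ps.finite_toSet.subset (fun P hP => hP.1))
        exact fun P hP => hPs P hP.1
      obtain ⟨n, hn⟩ := hbase a _ ho (by simp)
      refine ⟨n, fun P hP ha x hx => ?_⟩
      have := hn hx
      simp only [Set.mem_iInter] at this
      exact this P ⟨hP, ha⟩
    choose N hN using h1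
    obtain ⟨n, hn⟩ := (hA.image N).bddAbove
    have hle : ∀ m ≥ n, ∀ a ∈ A.carrier, ∀ P ∈ Ps, a ∈ P → U m a ⊆ P := by
      intro m hm a ha P hP haP
      exact (hanti a ((hn (Set.mem_image_of_mem N ha)).trans hm)).trans (hN a P hP haP)
    refine ⟨n, fun m hm B hB => ⟨?_, ?_⟩⟩
    · intro b hb
      obtain ⟨a, ha, hba⟩ := hB.1 b hb
      obtain ⟨P, hP, haP⟩ := hAS.1 ha
      exact ⟨P, hP, hle m hm a ha P hP haP hba⟩
    · intro P hP
      obtain ⟨a, ha, haP⟩ := hAS.2 P hP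
      obtain ⟨b, hb, hba⟩ := hB.2 a ha
      exact ⟨b, hb, hle m hm a ha P hP haP hba⟩
  | univ => exact ⟨0, fun _ _ => Set.subset_univ _⟩
  | inter s t _ _ ihs iht =>
    obtain ⟨n, hn⟩ := ihs hAS.1
    obtain ⟨k, hk⟩ := iht hAS.2
    exact ⟨max n k, fun m hm => Set.subset_inter (hn m (le_trans (le_max_left _ _) hm))
      (hk m (le_trans (le_max_right _ _) hm))⟩
  | sUnion T _ ih =>
    obtain ⟨s, hs, hAs⟩ := hAS
    obtain ⟨n, hn⟩ := ih s hs hAs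
    exact ⟨n, fun m hm => (hn m hm).trans (Set.subset_sUnion_of_mem hs)⟩

def sing {X : Type*} [TopologicalSpace X] (x : X) : VFin X :=
  ⟨⟨{x}, isCompact_singleton, Set.singleton_nonempty x⟩, Set.finite_singleton x⟩

theorem sing_cont {X : Type*} [TopologicalSpace X] : Continuous (sing : X → VFin X) := by
  refine Continuous.subtype_mk (f := fun x : X =>
    (⟨{x}, isCompact_singleton, Set.singleton_nonempty x⟩ : VHyper X)) ?_ _
  refine continuous_generateFrom_iff.2 ?_
  rintro _ ⟨Ps, hPs, rfl⟩
  have : ((fun x : X =>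
    (⟨{x}, isCompact_singleton, Set.singleton_nonempty x⟩ : VHyper X)) ⁻¹' VHyper.vbox Ps)
      = (⋃₀ (Ps : Set (Set X))) ∩ ⋂ P ∈ (Ps : Set (Set X)), P := by
    ext x
    simp [VHyper.vbox]
  rw [this]
  exact (isOpen_sUnion hPs).inter (Ps.finite_toSet.isOpen_biInter hPs)

/-- `X` is a Nagata space iff `ℱ(X)` is a Nagata space. -/
theorem statement15 {X : Type*} [TopologicalSpace X] [T2Space X] [RegularSpace X] :
    IsNagataSpace X ↔ IsNagataSpace (VFin X) := by
  constructor
  · rintro ⟨U, V, hUo, hU, hVo, hV, hdec, hbase, hsep⟩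
    refine ⟨fun n A => Subtype.val ⁻¹' gbox (U n) A.1.carrier,
      fun n A => Subtype.val ⁻¹' gbox (V n) A.1.carrier, ?_, ?_, ?_, ?_, ?_, ?_, ?_⟩
    · exact fun n A => (gbox_open _ _ A.2 (hUo n)).preimage continuous_subtype_val
    · exact fun n A => ⟨fun b hb => ⟨b, hb, hU n b⟩, fun b hb => ⟨b, hb, hU n b⟩⟩
    · exact fun n A => (gbox_open _ _ A.2 (hVo n)).preimage continuous_subtype_val
    · exact fun n A => ⟨fun b hb => ⟨b, hb, hV n b⟩, fun b hb => ⟨b, hb, hV n b⟩⟩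
    · rintro n A B ⟨h1, h2⟩
      refine ⟨fun b hb => ?_, fun a ha => ?_⟩
      · obtain ⟨a, ha, h⟩ := h1 b hb
        exact ⟨a, ha, hdec n a h⟩
      · obtain ⟨b, hb, h⟩ := h2 a ha
        exact ⟨b, hb, hdec n a h⟩
    · intro A W hW hAW
      obtain ⟨S, hS, rfl⟩ := isOpen_induced_iff.1 hW
      obtain ⟨n, hn⟩ := gbox_base U (fun y => antitone_nat_of_succ_le (fun n => hdec n y)) hbase
        S hS A.1 A.2 hAW
      exact ⟨n, Set.preimage_mono (hn n le_rfl)⟩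
    · intro n A B hB
      by_contra hne
      obtain ⟨C, hCA, hCB⟩ := Set.nonempty_iff_ne_empty.2 hne
      have key : ∀ a b c, c ∈ V n a → c ∈ V n b → b ∈ U n a := by
        intro a b c h1 h2
        by_contra hb
        have h3 : c ∈ V n a ∩ V n b := ⟨h1, h2⟩
        rw [hsep n a b hb] at h3
        exact h3
      apply hB
      refine ⟨fun b hb => ?_, fun a ha => ?_⟩
      · obtain ⟨c, hc, hcb⟩ := hCB.2 b hb
        obtain ⟨a, ha, hca⟩ := hCA.1 c hc
        exact ⟨a, ha, key a b c hca hcb⟩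
      · obtain ⟨c, hc, hca⟩ := hCA.2 a ha
        obtain ⟨b, hb, hcb⟩ := hCB.1 c hc
        exact ⟨b, hb, key a b c hca hcb⟩
  · rintro ⟨U, V, hUo, hU, hVo, hV, hdec, hbase, hsep⟩
    refine ⟨fun n x => sing ⁻¹' U n (sing x), fun n x => sing ⁻¹' V n (sing x),
      fun n x => (hUo n _).preimage sing_cont, fun n x => hU n _,
      fun n x => (hVo n _).preimage sing_cont, fun n x => hV n _,
      fun n x => Set.preimage_mono (hdec n _), ?_, ?_⟩
    · intro x W hW hx
      have ho : IsOpen (Subtype.val ⁻¹' gbox (fun _ => W) {x} : Set (VFin X)) :=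
        (gbox_open _ _ (Set.finite_singleton x) (fun _ => hW)).preimage continuous_subtype_val
      obtain ⟨n, hn⟩ := hbase (sing x) _ ho (by
        refine ⟨fun b hb => ⟨x, rfl, ?_⟩, fun a _ => ⟨x, rfl, hx⟩⟩
        obtain rfl : b = x := hb
        exact hx)
      refine ⟨n, fun y hy => ?_⟩
      obtain ⟨_, _, h⟩ := (hn hy).1 y rfl
      exact h
    · intro n x z hz
      rw [← Set.preimage_inter, hsep n _ _ hz, Set.preimage_empty]
end

section
/- A regular T2 space X has a point-regular base if and only if ℱ(X), the space of nonempty finite subsets of X with the Vietoris topology, has a point-regular base. -/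
open TopologicalSpace Set

/-- A point-regular base: a base such that for every point `y` and neighborhood `U` of `y`,
only finitely many members of the base contain `y` and meet the complement of `U`. -/
def HasPointRegularBase (Y : Type*) [TopologicalSpace Y] : Prop :=
  ∃ B : Set (Set Y), IsBaseFam B ∧
    ∀ y : Y, ∀ U ∈ nhds y, {b ∈ B | y ∈ b ∧ (b ∩ Uᶜ).Nonempty}.Finite

open Filter in
/-- strong development by point-finite open covers -/
theorem exists_dev {X : Type*} [TopologicalSpace X] [T2Space X] (h : HasPointRegularBase X) :
    ∃ W : ℕ → Set (Set X), (∀ n, ∀ u ∈ W n, IsOpen u) ∧ (∀ n x, ∃ u ∈ W n, x ∈ u) ∧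
      (∀ n x, {u ∈ W n | x ∈ u}.Finite) ∧
      (∀ x, ∀ V ∈ nhds x, ∀ᶠ n in atTop, ∀ u ∈ W n, x ∈ u → u ⊆ V) := by
  obtain ⟨B, ⟨hBo, hBb⟩, hB⟩ := h
  let r : Set X → ℕ := fun b => {c ∈ B | b ⊂ c}.ncard
  let M : ℕ → Set (Set X) := fun n => {b ∈ B | n ≤ r b ∧ ∀ c ∈ B, b ⊂ c → r c < n}
  let I : Set (Set X) := {s | ∃ x, s = {x} ∧ IsOpen ({x} : Set X)}
  have notsub : ∀ (b U : Set X), ¬ b ⊆ U → (b ∩ Uᶜ).Nonempty := by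
    intro b U hb
    obtain ⟨y, hy, hyU⟩ := Set.not_subset.1 hb
    exact ⟨y, hy, hyU⟩
  refine ⟨fun n => M n ∪ I, ?_, ?_, ?_, ?_⟩
  · rintro n u (hu | ⟨x, rfl, hx⟩)
    · exact hBo u hu.1
    · exact hx
  · intro n x
    by_cases hx : IsOpen ({x} : Set X)
    · exact ⟨{x}, Or.inr ⟨x, rfl, hx⟩, rfl⟩
    have hne : ∀ b ∈ B, x ∈ b → ∃ y ∈ b, y ≠ x := by
      intro b hb hxb
      by_contra hcon
      push Not at hcon
      have : b = {x} := Set.Subset.antisymm hcon (by simpa using hxb)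
      exact hx (this ▸ hBo b hb)
    have hfin : ∀ b ∈ B, x ∈ b → {c ∈ B | b ⊂ c}.Finite := by
      intro b hb hxb
      obtain ⟨y, hy, hyx⟩ := hne b hb hxb
      refine (hB x {y}ᶜ (isOpen_compl_singleton.mem_nhds (by simpa using hyx.symm))).subset ?_
      rintro c ⟨hc, hbc⟩
      exact ⟨hc, hbc.1 hxb, y, hbc.1 hy, by simp⟩
    have hlt : ∀ b ∈ B, x ∈ b → ∀ c ∈ B, b ⊂ c → r c < r b := by
      intro b hb hxb c hc hbc
      refine Set.ncard_lt_ncard ?_ (hfin b hb hxb)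
      refine ⟨fun d hd => ⟨hd.1, hbc.trans hd.2⟩, fun hh => ?_⟩
      exact (hh (show c ∈ {c ∈ B | b ⊂ c} from ⟨hc, hbc⟩)).2.ne rfl
    have hex : ∀ m, ∃ k, m ≤ k ∧ ∃ b ∈ B, x ∈ b ∧ r b = k := by
      intro m
      induction m with
      | zero =>
        obtain ⟨b, hb, hxb, -⟩ := hBb univ isOpen_univ x trivial
        exact ⟨r b, Nat.zero_le _, b, hb, hxb, rfl⟩
      | succ m ih =>
        obtain ⟨k, hk, b, hb, hxb, rfl⟩ := ih
        obtain ⟨y, hy, hyx⟩ := hne b hb hxb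
        obtain ⟨c, hc, hxc, hcb⟩ := hBb (b ∩ {y}ᶜ) ((hBo b hb).inter isOpen_compl_singleton) x
          ⟨hxb, by simpa using hyx.symm⟩
        have : r b < r c := hlt c hc hxc b hb
          ⟨fun z hz => (hcb hz).1, fun hh => (hcb (hh hy)).2 rfl⟩
        exact ⟨r c, by omega, c, hc, hxc, rfl⟩
    classical
    have hmin := fun k => Nat.find_min (hex n) (m := k)
    obtain ⟨hk, b, hb, hxb, hrb⟩ := Nat.find_spec (hex n)
    refine ⟨b, Or.inl ⟨hb, by omega, fun c hc hbc => ?_⟩, hxb⟩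
    by_contra hcon
    have h1 := hlt b hb hxb c hc hbc
    exact hmin (r c) (by omega) ⟨by omega, c, hc, hbc.1 hxb, rfl⟩
  · intro n x
    have h1 : {u ∈ M n | x ∈ u}.Finite := by
      by_cases hM : ∃ b ∈ M n, x ∈ b
      · obtain ⟨b, hb, hxb⟩ := hM
        refine ((hB x b ((hBo b hb.1).mem_nhds hxb)).insert b).subset ?_
        rintro c ⟨hc, hxc⟩
        by_cases hcb : c ⊆ b
        · left
          by_contra hne
          have := hc.2.2 b hb.1 (hcb.ssubset_of_ne hne)
          exact absurd hb.2.1 (by omega)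
        · exact Or.inr ⟨hc.1, hxc, notsub _ _ hcb⟩
      · convert Set.finite_empty
        ext c
        simp only [mem_ofPred_eq, mem_empty_iff_false, iff_false]
        exact fun hc => hM ⟨c, hc⟩
    refine (h1.insert {x}).subset ?_
    rintro u ⟨hu | ⟨y, rfl, -⟩, hxu⟩
    · exact Or.inr ⟨hu, hxu⟩
    · left
      rw [mem_singleton_iff.1 hxu]
  · intro x V hV
    obtain ⟨N, hN⟩ := ((hB x V hV).image r).bddAbove
    filter_upwards [eventually_gt_atTop N] with n hn
    rintro u (hu | ⟨y, rfl, -⟩) hxu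
    · by_contra hcon
      have h1 := hN (mem_image_of_mem r (⟨hu.1, hxu, notsub _ _ hcon⟩ :
        u ∈ {b ∈ B | x ∈ b ∧ (b ∩ Vᶜ).Nonempty}))
      have := hu.2.1
      omega
    · rw [← mem_singleton_iff.1 hxu]
      simpa using mem_of_mem_nhds hV

/-- box in the space of finite sets -/
def fbox {X : Type*} [TopologicalSpace X] (Ps : Finset (Set X)) : Set (VFin X) :=
  {A | A.1 ∈ VHyper.vbox Ps}

open Filter in
theorem fwd {X : Type*} [TopologicalSpace X] [T2Space X] (h : HasPointRegularBase X) :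
    HasPointRegularBase (VFin X) := by
  obtain ⟨W, hWo, hWc, hWf, hWd⟩ := exists_dev h
  have key : ∀ A : VFin X, ∀ O : Set (VHyper X), IsOpen O → A.1 ∈ O →
      ∀ᶠ n in atTop, ∀ Ps : Finset (Set X), (Ps : Set (Set X)) ⊆ W n → A ∈ fbox Ps →
        VHyper.vbox Ps ⊆ O := by
    intro A O hO
    induction hO with
    | univ => intro _; exact Eventually.of_forall fun _ _ _ _ => subset_univ _
    | inter s t _ _ ihs iht =>
      intro hA
      filter_upwards [ihs hA.1, iht hA.2] with n h1 h2 Ps hP hAP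
      exact subset_inter (h1 Ps hP hAP) (h2 Ps hP hAP)
    | sUnion S _ ih =>
      rintro ⟨s, hs, hA⟩
      filter_upwards [ih s hs hA] with n h1 Ps hP hAP
      exact (h1 Ps hP hAP).trans (subset_sUnion_of_mem hs)
    | basic s hs =>
      obtain ⟨Vs, hVo, rfl⟩ := hs
      intro hA
      have hev : ∀ᶠ n in atTop, ∀ a ∈ A.1.carrier, ∀ V ∈ Vs, a ∈ V →
          ∀ u ∈ W n, a ∈ u → u ⊆ V := by
        rw [eventually_all_finite A.2]
        intro a ha
        rw [eventually_all_finset]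
        intro V hV
        by_cases haV : a ∈ V
        · filter_upwards [hWd a V ((hVo V hV).mem_nhds haV)] with n hn _ using hn
        · exact Eventually.of_forall fun n h' => absurd h' haV
      filter_upwards [hev] with n hn Ps hP hAP C hC
      refine ⟨fun c hc => ?_, fun V hV => ?_⟩
      · obtain ⟨u, hu, hcu⟩ := hC.1 hc
        obtain ⟨a, ha, hau⟩ := hAP.2 u hu
        obtain ⟨V, hV, haV⟩ := hA.1 ha
        exact ⟨V, hV, hn a ha V hV haV u (hP hu) hau hcu⟩
      · obtain ⟨a, ha, haV⟩ := hA.2 V hV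
        obtain ⟨u, hu, hau⟩ := hAP.1 ha
        obtain ⟨c, hc, hcu⟩ := hC.2 u hu
        exact ⟨c, hc, hn a ha V hV haV u (hP hu) hau hcu⟩
  have key2 : ∀ A : VFin X, ∀ O ∈ nhds A,
      ∀ᶠ n in atTop, ∀ Ps : Finset (Set X), (Ps : Set (Set X)) ⊆ W n → A ∈ fbox Ps →
        fbox Ps ⊆ O := by
    intro A O hO
    obtain ⟨O', hO', ho, hA⟩ := mem_nhds_iff.1 hO
    obtain ⟨Q, hQ, rfl⟩ := isOpen_induced_iff.1 ho
    filter_upwards [key A Q hQ hA] with n hn Ps hP hAP C hC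
    exact hO' (hn Ps hP hAP hC)
  refine ⟨{b | ∃ n, ∃ Ps : Finset (Set X), (Ps : Set (Set X)) ⊆ W n ∧ b = fbox Ps}, ⟨?_, ?_⟩, ?_⟩
  · rintro _ ⟨n, Ps, hP, rfl⟩
    refine isOpen_induced_iff.2 ⟨VHyper.vbox Ps, ?_, rfl⟩
    exact TopologicalSpace.GenerateOpen.basic _ ⟨Ps, fun U hU => hWo n U (hP hU), rfl⟩
  · intro O hO A hA
    obtain ⟨n, hn⟩ := (key2 A O (hO.mem_nhds hA)).exists
    choose f hf hxf using hWc n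
    have hP : (((A.2.image f).toFinset : Finset (Set X)) : Set (Set X)) ⊆ W n := by
      intro u hu
      simp only [Finite.coe_toFinset] at hu
      obtain ⟨a, _, rfl⟩ := hu
      exact hf a
    have hAP : A ∈ fbox (A.2.image f).toFinset := by
      refine ⟨fun a ha => ⟨f a, ?_, hxf a⟩, fun P hP => ?_⟩
      · simp only [Finite.coe_toFinset]
        exact mem_image_of_mem f ha
      · rw [Finite.mem_toFinset] at hP
        obtain ⟨a, ha, rfl⟩ := hP
        exact ⟨a, ha, hxf a⟩
    exact ⟨_, ⟨n, _, hP, rfl⟩, hAP, hn _ hP hAP⟩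
  · intro A O hO
    obtain ⟨N, hN⟩ := eventually_atTop.1 (key2 A O hO)
    have hT : ∀ n, {u ∈ W n | (A.1.carrier ∩ u).Nonempty}.Finite := by
      intro n
      refine (A.2.biUnion fun a _ => hWf n a).subset ?_
      rintro u ⟨hu, a, ha, hau⟩
      exact mem_biUnion ha ⟨hu, hau⟩
    have hfin : (⋃ n ∈ Set.Iio N, fbox '' (((hT n).toFinset.powerset : Finset (Finset (Set X))) :
        Set (Finset (Set X)))).Finite :=
      (Set.finite_Iio N).biUnion fun n _ => (Finset.finite_toSet _).image _
    refine hfin.subset ?_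
    rintro _ ⟨⟨n, Ps, hP, rfl⟩, hA, C, hC, hCO⟩
    have hn : n < N := by
      by_contra hcon
      exact hCO (hN n (by omega) Ps hP hA hC)
    refine mem_biUnion (show n ∈ Set.Iio N from hn) ⟨Ps, ?_, rfl⟩
    simp only [Finset.coe_powerset, mem_preimage, mem_powerset_iff, Finite.coe_toFinset]
    exact fun u hu => ⟨hP hu, hA.2 u hu⟩

theorem bwd {X : Type*} [TopologicalSpace X] (h : HasPointRegularBase (VFin X)) :
    HasPointRegularBase X := by
  obtain ⟨B, ⟨hBo, hBb⟩, hB⟩ := h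
  let i : X → VFin X := fun x =>
    ⟨⟨{x}, isCompact_singleton, singleton_nonempty x⟩, finite_singleton x⟩
  have hi : Continuous i := by
    refine continuous_induced_rng.2 (continuous_generateFrom_iff.2 ?_)
    rintro _ ⟨Ps, hP, rfl⟩
    have : (Subtype.val ∘ i) ⁻¹' VHyper.vbox Ps
        = ⋃₀ (Ps : Set (Set X)) ∩ ⋂ P ∈ Ps, P := by
      ext x
      simp [VHyper.vbox, i]
    have h2 : IsOpen (⋃₀ (Ps : Set (Set X)) ∩ ⋂ P ∈ Ps, P) :=
      (isOpen_sUnion hP).inter (isOpen_biInter_finset hP)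
    exact this ▸ h2
  have ho : ∀ U : Set X, IsOpen U → IsOpen (fbox {U}) := fun U hU =>
    isOpen_induced_iff.2 ⟨VHyper.vbox {U},
      TopologicalSpace.GenerateOpen.basic _ ⟨{U}, by simpa using hU, rfl⟩, rfl⟩
  have hm : ∀ (U : Set X) x, i x ∈ fbox {U} ↔ x ∈ U := by
    intro U x
    change (({x} : Set X) ⊆ ⋃₀ ((({U} : Finset (Set X))) : Set (Set X)) ∧
      ∀ P ∈ ({U} : Finset (Set X)), (({x} : Set X) ∩ P).Nonempty) ↔ _
    simp
  refine ⟨(fun b => i ⁻¹' b) '' B, ⟨?_, ?_⟩, ?_⟩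
  · rintro _ ⟨b, hb, rfl⟩
    exact (hBo b hb).preimage hi
  · intro U hU x hx
    obtain ⟨b, hb, hxb, hbU⟩ := hBb (fbox {U}) (ho U hU) (i x) ((hm U x).2 hx)
    exact ⟨_, ⟨b, hb, rfl⟩, hxb, fun y hy => (hm U y).1 (hbU hy)⟩
  · intro x U hU
    obtain ⟨V, hVU, hV, hxV⟩ := mem_nhds_iff.1 hU
    refine ((hB (i x) (fbox {V}) ((ho V hV).mem_nhds ((hm V x).2 hxV))).image
      (fun b => i ⁻¹' b)).subset ?_
    rintro _ ⟨⟨b, hb, rfl⟩, hxb, y, hyb, hyU⟩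
    exact ⟨b, ⟨hb, hxb, i y, hyb, fun hy => hyU (hVU ((hm V y).1 hy))⟩, rfl⟩

/-- `X` has a point-regular base iff `ℱ(X)` has a point-regular base. -/
theorem statement16 {X : Type*} [TopologicalSpace X] [T2Space X] [RegularSpace X] :
    HasPointRegularBase X ↔ HasPointRegularBase (VFin X) :=
  ⟨fwd, bwd⟩
end

section
/- A regular T2 space X is c-semi-stratifiable if and only if ℱ(X), the space of nonempty finite subsets of X with the Vietoris topology, is c-semi-stratifiable. -/
open TopologicalSpace Set

/-- A c-semi-stratifiable space: every compact set `C` has a sequence of open sets `G n C`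
with `⋂ n, G n C = C`, monotone in `C`. -/
def CSemiStratifiable (Y : Type*) [TopologicalSpace Y] : Prop :=
  ∃ G : ℕ → Set Y → Set Y,
    (∀ n, ∀ C : Set Y, IsCompact C → IsOpen (G n C)) ∧
    (∀ C : Set Y, IsCompact C → ⋂ n, G n C = C) ∧
    (∀ n, ∀ C F : Set Y, IsCompact C → IsCompact F → C ⊆ F → G n C ⊆ G n F)


section Helpers

variable {X : Type*} [TopologicalSpace X]

theorem vfin_isOpen_sub {U : Set X} (hU : IsOpen U) :
    IsOpen {A : VFin X | A.1.carrier ⊆ U} := by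
  have h : IsOpen (VHyper.vbox ({U} : Finset (Set X))) :=
    isOpen_generateFrom_of_mem ⟨{U}, by simpa using hU, rfl⟩
  have h2 : IsOpen ((fun A : VFin X => A.1) ⁻¹' (VHyper.vbox ({U} : Finset (Set X)))) :=
    h.preimage continuous_subtype_val
  convert h2 using 1
  ext A
  simp only [VHyper.vbox, mem_ofPred_eq, mem_preimage, Finset.coe_singleton, sUnion_singleton,
    Finset.mem_singleton, forall_eq]
  constructor
  · intro hA
    refine ⟨hA, ?_⟩
    rw [inter_eq_left.2 hA]
    exact A.1.nonempty'
  · exact fun hA => hA.1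

open Classical in
theorem vfin_isOpen_hit {U : Set X} (hU : IsOpen U) :
    IsOpen {A : VFin X | (A.1.carrier ∩ U).Nonempty} := by
  have h : IsOpen (VHyper.vbox ({U, univ} : Finset (Set X))) :=
    isOpen_generateFrom_of_mem ⟨{U, univ}, by simpa using hU, rfl⟩
  have h2 : IsOpen ((fun A : VFin X => A.1) ⁻¹' (VHyper.vbox ({U, univ} : Finset (Set X)))) :=
    h.preimage continuous_subtype_val
  convert h2 using 1
  ext A
  have := A.1.nonempty'
  simp [VHyper.vbox, this]

theorem vfin_tendsto {F : ℕ → VFin X} {A : VFin X}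
    (h1 : ∀ U, IsOpen U → A.1.carrier ⊆ U → ∀ᶠ n in Filter.atTop, (F n).1.carrier ⊆ U)
    (h2 : ∀ U, IsOpen U → (A.1.carrier ∩ U).Nonempty →
      ∀ᶠ n in Filter.atTop, ((F n).1.carrier ∩ U).Nonempty) :
    Filter.Tendsto F Filter.atTop (nhds A) := by
  refine tendsto_subtype_rng.2 ?_
  refine tendsto_nhds_generateFrom_iff.2 ?_
  rintro s ⟨Ps, hPs, rfl⟩ hA
  have e1 := h1 _ (isOpen_sUnion (fun U hU => hPs U hU)) hA.1
  have e2 : ∀ᶠ n in Filter.atTop, ∀ P ∈ Ps, ((F n).1.carrier ∩ P).Nonempty :=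
    (Filter.eventually_all_finset Ps).2 fun P hP => h2 P (hPs P hP) (hA.2 P hP)
  filter_upwards [e1, e2] with n a b
  exact ⟨a, b⟩

theorem vfin_ext {A B : VFin X} (h : A.1.carrier = B.1.carrier) : A = B := by
  obtain ⟨⟨a, _, _⟩, _⟩ := A
  obtain ⟨⟨b, _, _⟩, _⟩ := B
  cases h
  rfl

theorem vfin_sep [T2Space X] {A B : VFin X} (h : ¬ A.1.carrier ⊆ B.1.carrier) :
    ∃ u v : Set (VFin X), IsOpen u ∧ IsOpen v ∧ A ∈ u ∧ B ∈ v ∧ Disjoint u v := by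
  obtain ⟨a, haA, haB⟩ := not_subset.1 h
  obtain ⟨U, V, hU, hV, haU, hBV, hd⟩ :=
    SeparatedNhds.of_isCompact_isCompact (isCompact_singleton (x := a)) B.1.isCompact'
      (disjoint_singleton_left.2 haB)
  refine ⟨_, _, vfin_isOpen_hit hU, vfin_isOpen_sub hV, ⟨a, haA, haU rfl⟩, hBV, ?_⟩
  rw [Set.disjoint_left]
  rintro C ⟨c, hc, hcU⟩ hC
  exact Set.disjoint_left.1 hd hcU (hC hc)

instance vfin_t2 [T2Space X] : T2Space (VFin X) := by
  refine ⟨fun A B hAB => ?_⟩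
  by_cases h : A.1.carrier ⊆ B.1.carrier
  · have h' : ¬ B.1.carrier ⊆ A.1.carrier := fun h' => hAB (vfin_ext (h.antisymm h'))
    obtain ⟨u, v, hu, hv, hB, hA, hd⟩ := vfin_sep h'
    exact ⟨v, u, hv, hu, hA, hB, hd.symm⟩
  · exact vfin_sep h

theorem vfin_union_compact {C : Set (VFin X)} (hC : IsCompact C) :
    IsCompact (⋃ F ∈ C, F.1.carrier) := by
  rw [isCompact_iff_finite_subcover]
  intro ι U hU hcov
  refine hC.induction_on (p := fun S => ∃ t : Finset ι, (⋃ F ∈ S, F.1.carrier) ⊆ ⋃ i ∈ t, U i)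
    ⟨∅, by simp⟩ ?_ ?_ ?_
  · rintro s t hst ⟨T, hT⟩
    exact ⟨T, (biUnion_subset_biUnion_left hst).trans hT⟩
  · classical
    rintro s t ⟨T, hT⟩ ⟨T', hT'⟩
    refine ⟨T ∪ T', ?_⟩
    rw [biUnion_union, Finset.set_biUnion_union]
    exact union_subset_union hT hT'
  · intro F hF
    obtain ⟨T, hT⟩ := F.1.isCompact'.elim_finite_subcover U hU
      ((subset_biUnion_of_mem (u := fun F : VFin X => F.1.carrier) hF).trans hcov)
    refine ⟨{A : VFin X | A.1.carrier ⊆ ⋃ i ∈ T, U i}, mem_nhdsWithin_of_mem_nhds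
      ((vfin_isOpen_sub (isOpen_biUnion fun i _ => hU i)).mem_nhds hT), T, ?_⟩
    exact iUnion₂_subset fun A hA => hA

/-- The singleton embedding. -/
def vfinSingle (x : X) : VFin X :=
  ⟨⟨{x}, isCompact_singleton, singleton_nonempty x⟩, finite_singleton x⟩

theorem vfinSingle_continuous : Continuous (vfinSingle : X → VFin X) := by
  refine Continuous.subtype_mk (continuous_generateFrom_iff.2 ?_) _
  rintro s ⟨Ps, hPs, rfl⟩
  have : (fun x : X => (⟨{x}, isCompact_singleton, singleton_nonempty x⟩ : VHyper X)) ⁻¹'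
      VHyper.vbox Ps = (⋃₀ (Ps : Set (Set X))) ∩ ⋂ P ∈ Ps, P := by
    ext x
    simp [VHyper.vbox]
  rw [this]
  exact (isOpen_sUnion fun U hU => hPs U hU).inter (isOpen_biInter_finset hPs)

theorem vfinSingle_inj : Function.Injective (vfinSingle : X → VFin X) := by
  intro x y h
  have : ({x} : Set X) = {y} := congrArg (fun A : VFin X => A.1.carrier) h
  exact singleton_injective this

theorem css_antitone (h : CSemiStratifiable X) : ∃ G : ℕ → Set X → Set X,
    (∀ n, ∀ C : Set X, IsCompact C → IsOpen (G n C)) ∧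
    (∀ C : Set X, IsCompact C → ⋂ n, G n C = C) ∧
    (∀ n, ∀ C F : Set X, IsCompact C → IsCompact F → C ⊆ F → G n C ⊆ G n F) ∧
    (∀ C m n, m ≤ n → G n C ⊆ G m C) := by
  obtain ⟨G, h1, h2, h3⟩ := h
  refine ⟨fun n C => ⋂ m ∈ Finset.range (n + 1), G m C, ?_, ?_, ?_, ?_⟩
  · exact fun n C hC => isOpen_biInter_finset fun m _ => h1 m C hC
  · intro C hC
    refine Eq.trans ?_ (h2 C hC)
    ext x
    simp only [mem_iInter, Finset.mem_range]
    exact ⟨fun h n => h n n (Nat.lt_succ_self n), fun h n m _ => h m⟩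
  · exact fun n C F hC hF hCF => iInter₂_mono fun m _ => h3 m C F hC hF hCF
  · intro C m n hmn x hx
    simp only [mem_iInter, Finset.mem_range] at hx ⊢
    exact fun i hi => hx i (by omega)

end Helpers

/-- `X` is c-semi-stratifiable iff `ℱ(X)` is c-semi-stratifiable. -/
theorem statement17 {X : Type*} [TopologicalSpace X] [T2Space X] [RegularSpace X] :
    CSemiStratifiable X ↔ CSemiStratifiable (VFin X) := by
  constructor
  · intro h
    obtain ⟨G, h1, h2, h3, h4⟩ := css_antitone h
    have hself : ∀ n x, x ∈ G n {x} := fun n x => by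
      have : x ∈ ⋂ n, G n {x} := by rw [h2 _ isCompact_singleton]; rfl
      exact mem_iInter.1 this n
    refine ⟨fun n C => ⋃ F ∈ C, ({A : VFin X | A.1.carrier ⊆ ⋃ x ∈ F.1.carrier, G n {x}} ∩
      ⋂ x ∈ F.1.carrier, {A : VFin X | (A.1.carrier ∩ G n {x}).Nonempty}), ?_, ?_, ?_⟩
    · intro n C _
      refine isOpen_biUnion fun F _ => (vfin_isOpen_sub (isOpen_biUnion fun x _ =>
        h1 n _ isCompact_singleton)).inter (F.2.isOpen_biInter fun x _ =>
          vfin_isOpen_hit (h1 n _ isCompact_singleton))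
    · intro C hC
      apply Subset.antisymm
      · intro A hA
        have hA' := fun n => mem_iUnion₂.1 (mem_iInter.1 hA n)
        choose F hFC hF using hA'
        set K := ⋃ F ∈ C, F.1.carrier with hK
        have hKc : IsCompact K := vfin_union_compact hC
        have hFK : ∀ n, ∀ x ∈ (F n).1.carrier, x ∈ K := fun n x hx =>
          mem_iUnion₂.2 ⟨F n, hFC n, hx⟩
        have key : ∀ U, IsOpen U → ∀ a ∈ U, ∀ᶠ n in Filter.atTop, a ∉ G n (K \ U) := by
          intro U hU a ha
          have : a ∉ ⋂ n, G n (K \ U) := by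
            rw [h2 _ (hKc.diff hU)]
            exact fun h => h.2 ha
          rw [mem_iInter, not_forall] at this
          obtain ⟨m, hm⟩ := this
          filter_upwards [Filter.eventually_ge_atTop m] with n hn hh
          exact hm (h4 _ m n hn hh)
        have key2 : ∀ U, IsOpen U → ∀ a n, a ∉ G n (K \ U) → ∀ x ∈ (F n).1.carrier,
            a ∈ G n {x} → x ∈ U := by
          intro U hU a n ha x hx hax
          by_contra hxU
          exact ha (h3 n _ _ isCompact_singleton (hKc.diff hU)
            (singleton_subset_iff.2 ⟨hFK n x hx, hxU⟩) hax)
        refine hC.isClosed.mem_of_tendsto (f := F) (b := Filter.atTop) (vfin_tendsto ?_ ?_)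
          (Filter.Eventually.of_forall hFC)
        · intro U hU hAU
          have := (Filter.eventually_all_finite A.2).2 fun a ha => key U hU a (hAU ha)
          filter_upwards [this] with n hn x hx
          obtain ⟨a, haA, hax⟩ := mem_iInter₂.1 (hF n).2 x hx
          exact key2 U hU a n (hn a haA) x hx hax
        · rintro U hU ⟨a, haA, haU⟩
          filter_upwards [key U hU a haU] with n hn
          obtain ⟨x, hx, hax⟩ := mem_iUnion₂.1 ((hF n).1 haA)
          exact ⟨x, hx, key2 U hU a n hn x hx hax⟩
      · intro F hF
        refine mem_iInter.2 fun n => mem_iUnion₂.2 ⟨F, hF, ?_, ?_⟩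
        · exact fun x hx => mem_iUnion₂.2 ⟨x, hx, hself n x⟩
        · exact mem_iInter₂.2 fun x hx => ⟨x, hx, hself n x⟩
    · exact fun n C F _ _ hCF => biUnion_subset_biUnion_left hCF
  · rintro ⟨G, h1, h2, h3⟩
    refine ⟨fun n C => vfinSingle ⁻¹' G n (vfinSingle '' C), ?_, ?_, ?_⟩
    · exact fun n C hC => (h1 n _ (hC.image vfinSingle_continuous)).preimage vfinSingle_continuous
    · intro C hC
      rw [← preimage_iInter, h2 _ (hC.image vfinSingle_continuous),
        preimage_image_eq _ vfinSingle_inj]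
    · exact fun n C F hC hF hCF => preimage_mono (h3 n _ _ (hC.image vfinSingle_continuous)
        (hF.image vfinSingle_continuous) (image_mono hCF))
end
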